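/- Let t be a binary tree and let S_1,…,S_m be a partition of the node set of t such that each S_i is a subtree of t, with shapes μ_1,…,μ_m. If p is a monotonic fixed-size binary tree source, then P[t] ≤ ∏_{i=1}^m P[μ_i]. -/

import Mathlib

inductive BinTree : Type where
  | leaf : BinTree
  | node : BinTree → BinTree → BinTree
deriving DecidableEq

namespace BinTree

def size : BinTree → ℕ
  | leaf => 0
  | node l r => 1 + size l + size r

def height : BinTree → ℕ
  | leaf => 0
  | node l r => 1 + max (height l) (height r)

def subtreeAt : BinTree → List Bool → BinTree
  | t, [] => t
  | leaf, _ :: _ => leaf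
  | node l r, b :: v => subtreeAt (if b then r else l) v

def countGE (b : ℕ) : BinTree → ℕ
  | leaf => 0
  | node l r => (if b ≤ size (node l r) then 1 else 0) + countGE b l + countGE b r

end BinTree

noncomputable def fsProb (p : ℕ → ℕ → ℝ) : BinTree → ℝ
  | .leaf => 1
  | .node l r => p l.size r.size * fsProb p l * fsProb p r

noncomputable def fhProb (p : ℕ → ℕ → ℝ) : BinTree → ℝ
  | .leaf => 1
  | .node l r => p l.height r.height * fhProb p l * fhProb p r

def IsFixedSizeSource (p : ℕ → ℕ → ℝ) : Prop :=
  (∀ ℓ r, 0 ≤ p ℓ r ∧ p ℓ r ≤ 1) ∧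
  ∀ n : ℕ, ∑ ℓ ∈ Finset.range (n + 1), p ℓ (n - ℓ) = 1

def IsFixedHeightSource (p : ℕ → ℕ → ℝ) : Prop :=
  (∀ i j, 0 ≤ p i j ∧ p i j ≤ 1) ∧
  ∀ h : ℕ,
    ∑ ij ∈ (Finset.range (h + 1) ×ˢ Finset.range (h + 1)).filter
        (fun ij => max ij.1 ij.2 = h), p ij.1 ij.2 = 1

/-- The addresses in `S` that descend into the `b`-child of the root,
re-rooted at that child. -/
def descend (b : Bool) (S : Finset (List Bool)) : Finset (List Bool) :=
  (S.filter fun v => v.head? = some b).image List.tail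

/-- The shape of the subtree induced by the address set `S` (rooted at the
root of the given tree): a node is kept iff its address lies in `S`. -/
def shapeOf : BinTree → Finset (List Bool) → BinTree
  | .leaf, _ => .leaf
  | .node l r, S =>
      if ([] : List Bool) ∈ S then
        .node (shapeOf l (descend false S)) (shapeOf r (descend true S))
      else .leaf

/-- `S` is (the address set of) a subtree of `t` with root `ρ`: it contains
`ρ`, consists of nodes of `t` that are descendants of `ρ`, and contains the
parent of each of its non-root elements. -/
def IsSubtreeSet (t : BinTree) (S : Finset (List Bool)) (ρ : List Bool) : Prop :=
  ρ ∈ S ∧ (∀ v ∈ S, ρ <+: v) ∧ (∀ v ∈ S, v ≠ ρ → v.dropLast ∈ S) ∧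
    (∀ v ∈ S, t.subtreeAt v ≠ BinTree.leaf)

theorem aux_mem_descend (b : Bool) (S : Finset (List Bool)) (v : List Bool) :
    v ∈ descend b S ↔ b :: v ∈ S := by
  unfold descend
  simp only [Finset.mem_image, Finset.mem_filter]
  constructor
  · rintro ⟨w, ⟨hw, hb⟩, rfl⟩
    cases w with
    | nil => simp at hb
    | cons a w =>
      simp at hb
      subst hb
      simpa using hw
  · intro h
    exact ⟨b :: v, ⟨h, by simp⟩, by simp⟩

theorem aux_decomp (S : Finset (List Bool)) (h : [] ∈ S) (f : List Bool → ℝ) :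
    ∏ v ∈ S, f v = f [] * (∏ v ∈ descend false S, f (false :: v)) *
      ∏ v ∈ descend true S, f (true :: v) := by
  have hS : S = insert [] ((descend false S).image (List.cons false) ∪
      (descend true S).image (List.cons true)) := by
    ext v
    rcases v with _ | ⟨b, v⟩
    · simp [h]
    · cases b <;> simp [aux_mem_descend]
  conv_lhs => rw [hS]
  rw [Finset.prod_insert (by simp), Finset.prod_union, Finset.prod_image (by simp),
    Finset.prod_image (by simp), mul_assoc]
  rw [Finset.disjoint_left]
  intro v hv hv'
  simp only [Finset.mem_image] at hv hv'
  obtain ⟨a, _, rfl⟩ := hv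
  obtain ⟨c, _, hc⟩ := hv'
  simp at hc

/-- The factor contributed by the node with address `v`. -/
noncomputable def auxQ (p : ℕ → ℕ → ℝ) (t : BinTree) (v : List Bool) : ℝ :=
  p (t.subtreeAt (v ++ [false])).size (t.subtreeAt (v ++ [true])).size

theorem aux_subtreeAt_nil (t : BinTree) : t.subtreeAt [] = t := by
  cases t <;> rfl

theorem aux_subtreeAt_leaf (v : List Bool) : BinTree.leaf.subtreeAt v = .leaf := by
  cases v <;> rfl

theorem aux_subtreeAt_cons (l r : BinTree) (b : Bool) (v : List Bool) :
    (BinTree.node l r).subtreeAt (b :: v) = (if b then r else l).subtreeAt v := rfl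

theorem aux_subtreeAt_append (t : BinTree) (u v : List Bool) :
    t.subtreeAt (u ++ v) = (t.subtreeAt u).subtreeAt v := by
  induction u generalizing t with
  | nil => simp [aux_subtreeAt_nil]
  | cons b u ih =>
    cases t with
    | leaf => simp [aux_subtreeAt_leaf]
    | node l r => rw [List.cons_append, aux_subtreeAt_cons, aux_subtreeAt_cons, ih]

theorem auxQ_append (p : ℕ → ℕ → ℝ) (t : BinTree) (u v : List Bool) :
    auxQ p t (u ++ v) = auxQ p (t.subtreeAt u) v := by
  unfold auxQ
  rw [List.append_assoc, List.append_assoc, aux_subtreeAt_append, aux_subtreeAt_append t u]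

theorem auxQ_cons (p : ℕ → ℕ → ℝ) (l r : BinTree) (b : Bool) (v : List Bool) :
    auxQ p (.node l r) (b :: v) = auxQ p (if b then r else l) v := rfl

theorem auxQ_nil (p : ℕ → ℕ → ℝ) (l r : BinTree) :
    auxQ p (.node l r) [] = p l.size r.size := by
  simp [auxQ, aux_subtreeAt_cons, aux_subtreeAt_nil]

theorem aux_fsProb (p : ℕ → ℕ → ℝ) (t : BinTree) (S : Finset (List Bool))
    (hS : ∀ v, v ∈ S ↔ t.subtreeAt v ≠ .leaf) : ∏ v ∈ S, auxQ p t v = fsProb p t := by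
  induction t generalizing S with
  | leaf =>
    have : S = ∅ := by
      ext v
      simp [hS, aux_subtreeAt_leaf]
    simp [this, fsProb]
  | node l r ihl ihr =>
    rw [aux_decomp S (by simp [hS, aux_subtreeAt_nil])]
    simp only [auxQ_nil, auxQ_cons]
    simp only [Bool.false_eq_true, if_false, if_true]
    rw [ihl, ihr, fsProb]
    · intro v
      rw [aux_mem_descend, hS, aux_subtreeAt_cons]
      simp
    · intro v
      rw [aux_mem_descend, hS, aux_subtreeAt_cons]
      simp

theorem aux_size (t : BinTree) (S : Finset (List Bool)) : (shapeOf t S).size ≤ t.size := by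
  induction t generalizing S with
  | leaf => simp [shapeOf]
  | node l r ihl ihr =>
    unfold shapeOf
    split_ifs
    · simp only [BinTree.size]
      have := ihl (descend false S)
      have := ihr (descend true S)
      omega
    · simp [BinTree.size]

theorem aux_nil_mem (S : Finset (List Bool)) (hS : ∀ v ∈ S, v.dropLast ∈ S)
    (v : List Bool) (hv : v ∈ S) : [] ∈ S := by
  induction v using List.reverseRecOn with
  | nil => exact hv
  | append_singleton l a ih => exact ih (by simpa using hS _ hv)

theorem aux_shape (p : ℕ → ℕ → ℝ) (h0 : ∀ a b, 0 ≤ p a b)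
    (hm : ∀ a b c d, a ≤ b → c ≤ d → p b d ≤ p a c)
    (t : BinTree) (S : Finset (List Bool))
    (hS : ∀ v ∈ S, v.dropLast ∈ S) (hl : ∀ v ∈ S, t.subtreeAt v ≠ .leaf) :
    ∏ v ∈ S, auxQ p t v ≤ fsProb p (shapeOf t S) := by
  have hq : ∀ (t : BinTree) (S : Finset (List Bool)), 0 ≤ ∏ v ∈ S, auxQ p t v :=
    fun t S => Finset.prod_nonneg fun v _ => h0 _ _
  induction t generalizing S with
  | leaf =>
    have : S = ∅ := by
      ext v
      have := hl v
      simpa [aux_subtreeAt_leaf] using this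
    simp [this, fsProb, shapeOf]
  | node l r ihl ihr =>
    by_cases hn : [] ∈ S
    · have hd : ∀ b, ∀ v ∈ descend b S, v.dropLast ∈ descend b S := by
        intro b v hv
        rw [aux_mem_descend] at hv ⊢
        rcases v with _ | ⟨c, v⟩
        · simpa using hv
        · simpa using hS _ hv
      rw [aux_decomp S hn]
      simp only [auxQ_nil, auxQ_cons]
      simp only [Bool.false_eq_true, if_false, if_true]
      unfold shapeOf
      rw [if_pos hn, fsProb]
      have h1 := ihl (descend false S) (hd _) (by
        intro v hv
        rw [aux_mem_descend] at hv
        simpa [aux_subtreeAt_cons] using hl _ hv)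
      have h2 := ihr (descend true S) (hd _) (by
        intro v hv
        rw [aux_mem_descend] at hv
        simpa [aux_subtreeAt_cons] using hl _ hv)
      have h3 := hm _ _ _ _ (aux_size l (descend false S)) (aux_size r (descend true S))
      exact mul_le_mul (mul_le_mul h3 h1 (hq _ _) (h0 _ _)) h2 (hq _ _)
        (mul_nonneg (h0 _ _) ((hq _ _).trans h1))
    · have : S = ∅ := by
        ext v
        simp only [Finset.notMem_empty, iff_false]
        exact fun hv => hn (aux_nil_mem S hS v hv)
      subst this
      simp [fsProb, shapeOf]

/-- monotonicity implies submultiplicativity (fixed-size case):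
if the nodes of `t` are partitioned into subtrees with shapes
`μ_1, …, μ_m`, then `P[t] ≤ ∏ P[μ_i]` for a monotonic fixed-size source. -/
theorem statement3 (p : ℕ → ℕ → ℝ) (hp : IsFixedSizeSource p)
    (hmono : ∀ ℓ r : ℕ, p (ℓ + 1) r ≤ p ℓ r ∧ p ℓ (r + 1) ≤ p ℓ r)
    (t : BinTree) (m : ℕ) (S : Fin m → Finset (List Bool)) (ρ : Fin m → List Bool)
    (hsub : ∀ i, IsSubtreeSet t (S i) (ρ i))
    (hdisj : ∀ i j, i ≠ j → Disjoint (S i) (S j))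
    (hcover : ∀ v : List Bool, t.subtreeAt v ≠ BinTree.leaf → ∃ i, v ∈ S i) :
    fsProb p t ≤ ∏ i : Fin m,
      fsProb p (shapeOf (t.subtreeAt (ρ i))
        ((S i).image fun v => v.drop (ρ i).length)) := by
  have h0 : ∀ a b, 0 ≤ p a b := fun a b => (hp.1 a b).1
  have hm : ∀ a b c d, a ≤ b → c ≤ d → p b d ≤ p a c := by
    intro a b c d hab hcd
    have e1 : p b d ≤ p a d :=
      antitone_nat_of_succ_le (f := fun x => p x d) (fun n => (hmono n d).1) hab
    have e2 : p a d ≤ p a c :=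
      antitone_nat_of_succ_le (f := fun x => p a x) (fun n => (hmono a n).2) hcd
    exact e1.trans e2
  rw [← aux_fsProb p t (Finset.univ.biUnion S), Finset.prod_biUnion]
  · apply Finset.prod_le_prod
    · intro i _
      exact Finset.prod_nonneg fun v _ => h0 _ _
    · intro i _
      obtain ⟨hr, hpre, hpar, hleaf⟩ := hsub i
      have key := aux_shape p h0 hm (t.subtreeAt (ρ i))
        ((S i).image fun v => v.drop (ρ i).length) (by
          intro w hw
          rw [Finset.mem_image] at hw ⊢
          obtain ⟨v, hv, rfl⟩ := hw
          obtain ⟨w, rfl⟩ := hpre v hv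
          by_cases hw : w = []
          · subst hw
            exact ⟨_, hv, by simp⟩
          · refine ⟨_, hpar _ hv (by simpa using hw), ?_⟩
            rw [List.dropLast_append_of_ne_nil hw]
            simp) (by
          intro w hw
          rw [Finset.mem_image] at hw
          obtain ⟨v, hv, rfl⟩ := hw
          obtain ⟨w, rfl⟩ := hpre v hv
          have := hleaf _ hv
          rw [aux_subtreeAt_append] at this
          simpa using this)
      rw [Finset.prod_image] at key
      · refine le_trans (le_of_eq (Finset.prod_congr rfl ?_)) key
        intro v hv
        obtain ⟨w, rfl⟩ := hpre v hv
        rw [auxQ_append]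
        simp
      · intro v hv v' hv' hvv
        obtain ⟨w, rfl⟩ := hpre v hv
        obtain ⟨w', rfl⟩ := hpre v' hv'
        simpa using hvv
  · intro i _ j _ hij
    exact hdisj i j hij
  · intro v
    simp only [Finset.mem_biUnion, Finset.mem_univ, true_and]
    exact ⟨fun ⟨i, hi⟩ => (hsub i).2.2.2 v hi, hcover v⟩
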